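/- Let m, r ≥ 1 be integers and let W ⊆ ℂ^m be an open neighborhood of 0. Let h = (h_{ρσ}) : W → Matrix(r,r,ℂ) be a C² map such that h(z) is Hermitian for every z ∈ W, h(0) is the identity matrix, and the real Fréchet derivative of h at 0 vanishes; define φ : W × ℂ^r → ℝ by φ(z, ξ) = Σ_{ρ,σ} h_{ρσ}(z) ξ_σ conj(ξ_ρ). Fix ξ₀ ∈ ℂ^r \ {0} and let A be the m × m Hermitian matrix with entries A_{ij} = −Σ_{ρ,σ=1}^r (∂²h_{ρσ}/∂z_i∂z̄_j)(0) · ξ₀_σ · conj(ξ₀_ρ). If A has exactly s positive and exactly t negative eigenvalues, then the restriction of the Hermitian form (η, ζ) ↦ L_φ((0,ξ₀); (η,ζ)) to the complex hyperplane H = {(η, ζ) ∈ ℂ^m × ℂ^r : Σ_{ρ=1}^r ζ_ρ conj(ξ₀_ρ) = 0} (the maximal complex tangent space at (0,ξ₀) to the level set {φ = φ(0,ξ₀)}) has exactly t + r − 1 positive eigenvalues and exactly s negative eigenvalues. -/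

import Mathlib

open Set Metric Complex Bornology

noncomputable section

/-- The Levi form of a C² function `ρ` at `x` in direction `v`:
`L_ρ(x;v) = (1/4)(D²ρ(x)[v,v] + D²ρ(x)[iv,iv])`. -/
def leviForm {E : Type*} [NormedAddCommGroup E] [NormedSpace ℂ E]
    (ρ : E → ℝ) (x v : E) : ℝ :=
  (1 / 4) * (iteratedFDeriv ℝ 2 ρ x ![v, v] +
    iteratedFDeriv ℝ 2 ρ x ![Complex.I • v, Complex.I • v])

/-- The Levi form of `ρ` at `x` has at least `r` positive eigenvalues: there is an
`r`-dimensional complex subspace on which it is positive on nonzero vectors. -/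
def LeviPosEigenAtLeast {E : Type*} [NormedAddCommGroup E] [NormedSpace ℂ E]
    (ρ : E → ℝ) (x : E) (r : ℕ) : Prop :=
  ∃ V : Submodule ℂ E, Module.finrank ℂ V = r ∧ ∀ v ∈ V, v ≠ 0 → 0 < leviForm ρ x v

/-- A bounded strongly pseudoconvex domain in `ℂ^d` with boundary of class `C^ℓ`. -/
def IsSPCDomain {d : ℕ} (D : Set (EuclideanSpace ℂ (Fin d))) (ℓ : ℕ∞) : Prop :=
  IsOpen D ∧ IsConnected D ∧ IsBounded D ∧
  ∃ (U : Set (EuclideanSpace ℂ (Fin d))) (rD : EuclideanSpace ℂ (Fin d) → ℝ),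
    IsOpen U ∧ frontier D ⊆ U ∧ ContDiffOn ℝ ℓ rD U ∧
    D ∩ U = {x ∈ U | rD x < 0} ∧
    (∀ x ∈ frontier D, fderiv ℝ rD x ≠ 0) ∧
    (∀ x ∈ frontier D, ∀ v : EuclideanSpace ℂ (Fin d), v ≠ 0 →
      fderiv ℝ rD x v = 0 → fderiv ℝ rD x (Complex.I • v) = 0 → 0 < leviForm rD x v)

/-- The Wirtinger derivative `∂f/∂z_i`, computed from the real Fréchet derivative. -/
def wDz {m : ℕ} (i : Fin m) (f : EuclideanSpace ℂ (Fin m) → ℂ) :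
    EuclideanSpace ℂ (Fin m) → ℂ := fun x =>
  (1 / 2) * (fderiv ℝ f x (EuclideanSpace.single i 1)
    - Complex.I * fderiv ℝ f x (Complex.I • EuclideanSpace.single i 1))

/-- The Wirtinger derivative `∂f/∂z̄_j`, computed from the real Fréchet derivative. -/
def wDzbar {m : ℕ} (j : Fin m) (f : EuclideanSpace ℂ (Fin m) → ℂ) :
    EuclideanSpace ℂ (Fin m) → ℂ := fun x =>
  (1 / 2) * (fderiv ℝ f x (EuclideanSpace.single j 1)
    + Complex.I * fderiv ℝ f x (Complex.I • EuclideanSpace.single j 1))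

/-- The squared-norm function `φ(z,ξ) = Σ_{ρ,σ} h_{ρσ}(z) ξ_σ ξ̄_ρ` of a Hermitian
metric `h`, as a real-valued function (real since `h(z)` is a Hermitian matrix). -/
def sqNormFun {m r : ℕ} (h : EuclideanSpace ℂ (Fin m) → Fin r → Fin r → ℂ)
    (p : EuclideanSpace ℂ (Fin m) × EuclideanSpace ℂ (Fin r)) : ℝ :=
  (∑ ρ : Fin r, ∑ σ : Fin r,
    h p.1 ρ σ * p.2 σ * (starRingEnd ℂ) (p.2 ρ)).re

section SecondDerivative

variable {E F : Type*} [NormedAddCommGroup E] [NormedSpace ℝ E]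
  [NormedAddCommGroup F] [NormedSpace ℝ F]

theorem ContDiffAt.differentiableAt_fderiv {f : E → F} {x : E} (hf : ContDiffAt ℝ 2 f x) :
    DifferentiableAt ℝ (fderiv ℝ f) x :=
  (hf.fderiv_right (m := 1) (by norm_num)).differentiableAt (by norm_num)

theorem ContDiffAt.eventually_differentiableAt {f : E → F} {x : E} (hf : ContDiffAt ℝ 2 f x) :
    ∀ᶠ y in nhds x, DifferentiableAt ℝ f y :=
  (hf.eventually (by simp)).mono fun _ hy => hy.differentiableAt (by norm_num)

/-- The second derivative of a product, in one direction. -/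
theorem fderiv_fderiv_mul_apply_self {f g : E → ℂ} {x : E} (hf : ContDiffAt ℝ 2 f x)
    (hg : ContDiffAt ℝ 2 g x) (v : E) :
    fderiv ℝ (fderiv ℝ (fun y => f y * g y)) x v v =
      f x * fderiv ℝ (fderiv ℝ g) x v v + 2 * (fderiv ℝ f x v * fderiv ℝ g x v) +
        fderiv ℝ (fderiv ℝ f) x v v * g x := by
  have hev : fderiv ℝ (fun y => f y * g y) =ᶠ[nhds x]
      fun y => f y • fderiv ℝ g y + g y • fderiv ℝ f y := by
    filter_upwards [hf.eventually_differentiableAt, hg.eventually_differentiableAt] with y hfy hgy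
    exact fderiv_fun_mul hfy hgy
  have hfx : DifferentiableAt ℝ f x := hf.differentiableAt (by norm_num)
  have hgx : DifferentiableAt ℝ g x := hg.differentiableAt (by norm_num)
  have hf' := hf.differentiableAt_fderiv
  have hg' := hg.differentiableAt_fderiv
  rw [hev.fderiv_eq, fderiv_fun_add (hfx.fun_smul hg') (hgx.fun_smul hf'),
    fderiv_fun_smul hfx hg', fderiv_fun_smul hgx hf']
  simp
  ring

theorem fderiv_fderiv_comp_continuousLinearMap_apply {G : Type*} [NormedAddCommGroup G]
    [NormedSpace ℝ G] {f : E → F} (L : G →L[ℝ] E) {x : G} (hf : ContDiffAt ℝ 2 f (L x)) (v w : G) :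
    fderiv ℝ (fderiv ℝ (fun y => f (L y))) x v w =
      fderiv ℝ (fderiv ℝ f) (L x) (L v) (L w) := by
  have hev : fderiv ℝ (fun y => f (L y)) =ᶠ[nhds x]
      fun y => (ContinuousLinearMap.compL ℝ G E F).flip L (fderiv ℝ f (L y)) := by
    filter_upwards [L.continuous.continuousAt.eventually hf.eventually_differentiableAt] with y hy
    simpa using! fderiv_comp y hy L.differentiableAt
  have hd : HasFDerivAt (fun y => fderiv ℝ f (L y)) ((fderiv ℝ (fderiv ℝ f) (L x)).comp L) x :=
    hf.differentiableAt_fderiv.hasFDerivAt.comp x L.hasFDerivAt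
  have hd' := ((ContinuousLinearMap.compL ℝ G E F).flip L).hasFDerivAt.comp x hd
  rw [hev.fderiv_eq]
  exact DFunLike.congr_fun (DFunLike.congr_fun hd'.fderiv v) w

theorem fderiv_fderiv_continuousLinearMap (L : E →L[ℝ] F) (x : E) :
    fderiv ℝ (fderiv ℝ L) x = 0 := by
  rw [funext fun y => L.fderiv (x := y)]
  simp

end SecondDerivative

section Wirtinger

variable {E : Type*} [NormedAddCommGroup E] [NormedSpace ℂ E]

theorem smul_eq_re_add_im (c : ℂ) (v : E) : c • v = c.re • v + c.im • (I • v) := by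
  conv_lhs => rw [← re_add_im c, add_smul, mul_smul]
  simp

theorem I_smul_smul_eq (c : ℂ) (v : E) : I • c • v = c.re • (I • v) - c.im • v := by
  rw [smul_eq_re_add_im c v, smul_add, smul_comm I c.re, smul_comm I c.im, ← mul_smul I I]
  simp [sub_eq_add_neg]

/-- The part of a real bilinear map that is complex linear in its first and conjugate linear in
its second argument; for a second derivative this is the form with matrix `∂²/∂zᵢ∂z̄ⱼ`. -/
def sesquilinearPart (B : E →L[ℝ] E →L[ℝ] ℂ) : E →ₗ[ℂ] E →ₛₗ[starRingEnd ℂ] ℂ :=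
  LinearMap.mk₂'ₛₗ (RingHom.id ℂ) (starRingEnd ℂ)
    (fun v w => (1 / 4) * (B v w + I * B v (I • w) - I * B (I • v) w + B (I • v) (I • w)))
    (fun v v' w => by simp; ring)
    (fun c v w => by
      rw [I_smul_smul_eq, smul_eq_re_add_im c v, ← re_add_im c]
      generalize c.re = a, c.im = b
      simp
      ring_nf
      simp
      ring)
    (fun v w w' => by simp; ring)
    (fun c v w => by
      rw [I_smul_smul_eq, smul_eq_re_add_im c w, ← re_add_im c]
      generalize c.re = a, c.im = b
      simp
      ring_nf
      simp
      ring)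

theorem sesquilinearPart_apply (B : E →L[ℝ] E →L[ℝ] ℂ) (v w : E) :
    sesquilinearPart B v w =
      (1 / 4) * (B v w + I * B v (I • w) - I * B (I • v) w + B (I • v) (I • w)) :=
  rfl

theorem sesquilinearPart_self {B : E →L[ℝ] E →L[ℝ] ℂ} (hB : ∀ v w, B v w = B w v) (v : E) :
    sesquilinearPart B v v = (1 / 4) * (B v v + B (I • v) (I • v)) := by
  rw [sesquilinearPart_apply, hB (I • v) v]
  ring

variable {m : ℕ}

theorem wDz_wDzbar_eq_sesquilinearPart {f : EuclideanSpace ℂ (Fin m) → ℂ}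
    {x : EuclideanSpace ℂ (Fin m)} (hf : ContDiffAt ℝ 2 f x) (i j : Fin m) :
    wDz i (wDzbar j f) x = sesquilinearPart (fderiv ℝ (fderiv ℝ f) x)
      (EuclideanSpace.single i 1) (EuclideanSpace.single j 1) := by
  have hd (u : EuclideanSpace ℂ (Fin m)) : HasFDerivAt (fun y => fderiv ℝ f y u)
      ((fderiv ℝ (fderiv ℝ f) x).flip u) x :=
    by simpa using! hf.differentiableAt_fderiv.hasFDerivAt.clm_apply (hasFDerivAt_const u x)
  have hbar : HasFDerivAt (wDzbar j f) _ x :=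
    ((hd (EuclideanSpace.single j 1)).add
      ((hd (I • EuclideanSpace.single j 1)).const_mul I)).const_mul (1 / 2)
  rw [wDz, hbar.fderiv, sesquilinearPart_apply]
  simp
  ring_nf
  simp
  ring

theorem EuclideanSpace.sum_smul_single (v : EuclideanSpace ℂ (Fin m)) :
    v = ∑ i, v i • EuclideanSpace.single i (1 : ℂ) := by
  simpa using ((EuclideanSpace.basisFun (Fin m) ℂ).sum_repr v).symm

theorem sum_wDz_wDzbar_mul {f : EuclideanSpace ℂ (Fin m) → ℂ}
    {x : EuclideanSpace ℂ (Fin m)} (hf : ContDiffAt ℝ 2 f x) (v : EuclideanSpace ℂ (Fin m)) :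
    ∑ i, ∑ j, wDz i (wDzbar j f) x * v i * (starRingEnd ℂ) (v j) =
      (1 / 4) * (fderiv ℝ (fderiv ℝ f) x v v + fderiv ℝ (fderiv ℝ f) x (I • v) (I • v)) := by
  have hsymm := hf.isSymmSndFDerivAt (by simp)
  rw [← sesquilinearPart_self fun v w => hsymm v w]
  conv_rhs => rw [EuclideanSpace.sum_smul_single v]
  simp only [map_sum, LinearMap.sum_apply, map_smul, LinearMap.smul_apply, map_smulₛₗ,
    smul_eq_mul, Finset.mul_sum]
  rw [Finset.sum_comm]
  refine Finset.sum_congr rfl fun i _ => Finset.sum_congr rfl fun j _ => ?_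
  rw [wDz_wDzbar_eq_sesquilinearPart hf]
  ring

end Wirtinger

section LeviForm

variable {m r : ℕ}

theorem fderiv_fderiv_mul_conj_apply_self {E : Type*} [NormedAddCommGroup E]
    [NormedSpace ℝ E] (a b : E →L[ℝ] ℂ) (x v : E) :
    fderiv ℝ (fderiv ℝ (fun y => a y * (starRingEnd ℂ) (b y))) x v v =
      2 * (a v * (starRingEnd ℂ) (b v)) := by
  let b' : E →L[ℝ] ℂ := conjCLE.toContinuousLinearMap.comp b
  have := fderiv_fderiv_mul_apply_self a.contDiff.contDiffAt b'.contDiff.contDiffAt (x := x) v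
  rw [fderiv_fderiv_continuousLinearMap, fderiv_fderiv_continuousLinearMap] at this
  simpa [b'] using! this

theorem fderiv_fderiv_metric_term_apply_self {f : EuclideanSpace ℂ (Fin m) → ℂ}
    {p v : EuclideanSpace ℂ (Fin m) × EuclideanSpace ℂ (Fin r)} (hf : ContDiffAt ℝ 2 f p.1)
    (hf' : fderiv ℝ f p.1 = 0) (ρ σ : Fin r) :
    fderiv ℝ (fderiv ℝ (fun q : EuclideanSpace ℂ (Fin m) × EuclideanSpace ℂ (Fin r) =>
        f q.1 * (q.2 σ * (starRingEnd ℂ) (q.2 ρ)))) p v v =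
      f p.1 * (2 * (v.2 σ * (starRingEnd ℂ) (v.2 ρ))) +
        fderiv ℝ (fderiv ℝ f) p.1 v.1 v.1 * (p.2 σ * (starRingEnd ℂ) (p.2 ρ)) := by
  let c (k : Fin r) : (EuclideanSpace ℂ (Fin m) × EuclideanSpace ℂ (Fin r)) →L[ℝ] ℂ :=
    ((EuclideanSpace.proj k : EuclideanSpace ℂ (Fin r) →L[ℂ] ℂ).restrictScalars ℝ).comp
      (ContinuousLinearMap.snd ℝ _ _)
  let L := ContinuousLinearMap.fst ℝ (EuclideanSpace ℂ (Fin m)) (EuclideanSpace ℂ (Fin r))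
  have hfst : ContDiffAt ℝ 2 (fun q : EuclideanSpace ℂ (Fin m) × EuclideanSpace ℂ (Fin r) =>
      f q.1) p := hf.comp p contDiffAt_fst
  have hg : ContDiffAt ℝ 2 (fun q => c σ q * (starRingEnd ℂ) (c ρ q)) p :=
    (c σ).contDiff.contDiffAt.mul
      (conjCLE.contDiff.contDiffAt.comp p (c ρ).contDiff.contDiffAt)
  have hzero : fderiv ℝ (fun q : EuclideanSpace ℂ (Fin m) × EuclideanSpace ℂ (Fin r) =>
      f q.1) p = 0 := by
    refine (fderiv_comp p (hf.differentiableAt (by norm_num)) differentiableAt_fst).trans ?_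
    rw [hf', ContinuousLinearMap.zero_comp]
  have hmul := fderiv_fderiv_mul_apply_self hfst hg v
  have hcomp : fderiv ℝ (fderiv ℝ (fun q : EuclideanSpace ℂ (Fin m) × EuclideanSpace ℂ (Fin r) =>
      f q.1)) p v v = fderiv ℝ (fderiv ℝ f) p.1 v.1 v.1 :=
    fderiv_fderiv_comp_continuousLinearMap_apply L hf v v
  rw [hzero, fderiv_fderiv_mul_conj_apply_self, hcomp] at hmul
  simpa using! hmul

theorem leviForm_sqNormFun {h : EuclideanSpace ℂ (Fin m) → Fin r → Fin r → ℂ}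
    (hC2 : ∀ ρ σ, ContDiffAt ℝ 2 (fun z => h z ρ σ) 0)
    (hid : ∀ ρ σ, h 0 ρ σ = if ρ = σ then 1 else 0)
    (hd0 : ∀ ρ σ, fderiv ℝ (fun z => h z ρ σ) 0 = 0) (ξ : EuclideanSpace ℂ (Fin r))
    (v : EuclideanSpace ℂ (Fin m) × EuclideanSpace ℂ (Fin r)) :
    leviForm (sqNormFun h) (0, ξ) v = ‖v.2‖ ^ 2 +
      (∑ i, ∑ j, (∑ ρ, ∑ σ, wDz i (wDzbar j (fun z => h z ρ σ)) 0 * ξ σ *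
        (starRingEnd ℂ) (ξ ρ)) * v.1 i * (starRingEnd ℂ) (v.1 j)).re := by
  let F (ρ σ : Fin r) (q : EuclideanSpace ℂ (Fin m) × EuclideanSpace ℂ (Fin r)) : ℂ :=
    h q.1 ρ σ * (q.2 σ * (starRingEnd ℂ) (q.2 ρ))
  have hF (ρ σ : Fin r) : ContDiffAt ℝ 2 (F ρ σ) (0, ξ) := by
    have hcoord (k : Fin r) : ContDiff ℝ 2
        (fun q : EuclideanSpace ℂ (Fin m) × EuclideanSpace ℂ (Fin r) => q.2 k) :=
      (((EuclideanSpace.proj k : EuclideanSpace ℂ (Fin r) →L[ℂ] ℂ).restrictScalars ℝ).comp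
        (ContinuousLinearMap.snd ℝ (EuclideanSpace ℂ (Fin m)) _)).contDiff
    exact (ContDiffAt.comp (0, ξ) (hC2 ρ σ) contDiffAt_fst).mul
      ((hcoord σ).mul (conjCLE.contDiff.comp (hcoord ρ))).contDiffAt
  have hsnd (w : EuclideanSpace ℂ (Fin m) × EuclideanSpace ℂ (Fin r)) :
      iteratedFDeriv ℝ 2 (sqNormFun h) (0, ξ) ![w, w] =
        (∑ ρ, ∑ σ, (h 0 ρ σ * (2 * (w.2 σ * (starRingEnd ℂ) (w.2 ρ))) +
          fderiv ℝ (fderiv ℝ (fun z => h z ρ σ)) 0 w.1 w.1 *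
            (ξ σ * (starRingEnd ℂ) (ξ ρ)))).re := by
    have hφ : sqNormFun h = reCLM ∘ fun q => ∑ ρ, ∑ σ, F ρ σ q := by
      ext q
      simp [sqNormFun, F, mul_assoc]
    rw [hφ, reCLM.iteratedFDeriv_comp_left (n := 2)
      (ContDiffAt.sum fun ρ _ => ContDiffAt.sum fun σ _ => hF ρ σ) le_rfl,
      iteratedFDeriv_fun_sum_apply fun ρ _ => ContDiffAt.sum fun σ _ => hF ρ σ]
    rw [Finset.sum_congr rfl fun ρ _ => iteratedFDeriv_fun_sum_apply fun σ _ => hF ρ σ]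
    simp only [ContinuousLinearMap.compContinuousMultilinearMap_coe, Function.comp_apply,
      _root_.sum_apply, iteratedFDeriv_two_apply, reCLM_apply]
    congr 1
    refine Finset.sum_congr rfl fun ρ _ => Finset.sum_congr rfl fun σ _ => ?_
    exact fderiv_fderiv_metric_term_apply_self (p := (0, ξ)) (hC2 ρ σ) (hd0 ρ σ) ρ σ
  have hz : ∑ i, ∑ j, (∑ ρ, ∑ σ, wDz i (wDzbar j (fun z => h z ρ σ)) 0 * ξ σ *
        (starRingEnd ℂ) (ξ ρ)) * v.1 i * (starRingEnd ℂ) (v.1 j) =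
      ∑ ρ, ∑ σ, (1 / 4) * (fderiv ℝ (fderiv ℝ (fun z => h z ρ σ)) 0 v.1 v.1 +
        fderiv ℝ (fderiv ℝ (fun z => h z ρ σ)) 0 (I • v.1) (I • v.1)) *
          (ξ σ * (starRingEnd ℂ) (ξ ρ)) := by
    simp_rw [← fun ρ σ => sum_wDz_wDzbar_mul (hC2 ρ σ) v.1, Finset.sum_mul]
    rw [Finset.sum_comm_cycle]
    refine Finset.sum_congr rfl fun ρ _ => ?_
    rw [Finset.sum_comm_cycle]
    refine Finset.sum_congr rfl fun σ _ => Finset.sum_congr rfl fun i _ =>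
      Finset.sum_congr rfl fun j _ => ?_
    ring
  have hnorm : (‖v.2‖ ^ 2 : ℝ) =
      (∑ ρ, ∑ σ, h 0 ρ σ * (v.2 σ * (starRingEnd ℂ) (v.2 ρ))).re := by
    simp only [hid, ite_mul, one_mul, zero_mul, Finset.sum_ite_eq, Finset.mem_univ, if_true,
      EuclideanSpace.norm_sq_eq, mul_conj, re_sum, ofReal_re, normSq_eq_norm_sq]
  rw [leviForm, hsnd, hsnd, hz, hnorm, ← add_re, ← add_re,
    ← re_ofReal_mul, ← Finset.sum_add_distrib, ← Finset.sum_add_distrib, Finset.mul_sum]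
  congr 1
  refine Finset.sum_congr rfl fun ρ _ => ?_
  rw [← Finset.sum_add_distrib, ← Finset.sum_add_distrib, Finset.mul_sum]
  refine Finset.sum_congr rfl fun σ _ => ?_
  simp
  ring_nf
  simp
  ring

end LeviForm

section LinearAlgebra

theorem Submodule.finrank_prod_eq {K M N : Type*} [DivisionRing K] [AddCommGroup M] [Module K M]
    [AddCommGroup N] [Module K N] [FiniteDimensional K M] [FiniteDimensional K N]
    (p : Submodule K M) (q : Submodule K N) :
    Module.finrank K (p.prod q) = Module.finrank K p + Module.finrank K q := by
  let e : p.prod q ≃ₗ[K] p × q :=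
    { toFun := fun x => (⟨x.1.1, x.2.1⟩, ⟨x.1.2, x.2.2⟩)
      invFun := fun x => ⟨(x.1, x.2), x.1.2, x.2.2⟩
      map_add' := fun _ _ => rfl
      map_smul' := fun _ _ => rfl }
  rw [e.finrank_eq, Module.finrank_prod]

/-- A subspace of `H` that meets a subspace `N` of `H` trivially has dimension at most the
codimension of `N` in `H`. -/
theorem Submodule.finrank_add_finrank_le_of_disjoint_of_le {K M : Type*} [DivisionRing K]
    [AddCommGroup M] [Module K M] [FiniteDimensional K M] {V N H : Submodule K M}
    (hVN : Disjoint V N) (hV : V ≤ H) (hN : N ≤ H) :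
    Module.finrank K V + Module.finrank K N ≤ Module.finrank K H := by
  rw [← Submodule.finrank_sup_add_finrank_inf_eq, hVN.eq_bot, finrank_bot, add_zero]
  exact Submodule.finrank_mono (sup_le hV hN)

/-- The subspace of vectors whose coordinates outside `p` vanish. -/
def coordSubspace {ι M : Type*} [AddCommGroup M] [Module ℂ M] (c : M ≃ₗ[ℂ] (ι → ℂ))
    (p : ι → Prop) : Submodule ℂ M :=
  (⨅ i ∈ {i | ¬ p i}, LinearMap.ker (LinearMap.proj i : (ι → ℂ) →ₗ[ℂ] ℂ)).comap c.toLinearMap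

theorem mem_coordSubspace {ι M : Type*} [AddCommGroup M] [Module ℂ M] {c : M ≃ₗ[ℂ] (ι → ℂ)}
    {p : ι → Prop} {x : M} : x ∈ coordSubspace c p ↔ ∀ i, ¬ p i → c x i = 0 := by
  simp [coordSubspace]

open Classical in
theorem finrank_coordSubspace {ι M : Type*} [Fintype ι] [AddCommGroup M] [Module ℂ M]
    (c : M ≃ₗ[ℂ] (ι → ℂ)) (p : ι → Prop) :
    Module.finrank ℂ (coordSubspace c p) = Fintype.card {i // p i} := by
  have hd : IsCompl {i | p i} {i | ¬ p i} := isCompl_compl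
  rw [coordSubspace, Submodule.comap_equiv_eq_map_symm, LinearEquiv.finrank_map_eq,
    (LinearMap.iInfKerProjEquiv ℂ (fun _ : ι => ℂ) hd.disjoint
      hd.codisjoint.top_le).finrank_eq, Module.finrank_fintype_fun_eq_card]
  rfl

section WeightedSum

variable {ι M : Type*} [AddCommGroup M] [Module ℂ M] {c : M ≃ₗ[ℂ] (ι → ℂ)} {p : ι → Prop}
  {w : ι → ℝ} {x : M}

theorem mul_norm_sq_nonneg_of_mem_coordSubspace (hw : ∀ i, p i → 0 ≤ w i)
    (hx : x ∈ coordSubspace c p) (i : ι) : 0 ≤ w i * ‖c x i‖ ^ 2 := by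
  by_cases hi : p i
  · exact mul_nonneg (hw i hi) (sq_nonneg _)
  · simp [mem_coordSubspace.1 hx i hi]

theorem sum_mul_norm_sq_nonneg_of_mem_coordSubspace [Fintype ι] (hw : ∀ i, p i → 0 ≤ w i)
    (hx : x ∈ coordSubspace c p) : 0 ≤ ∑ i, w i * ‖c x i‖ ^ 2 :=
  Finset.sum_nonneg fun i _ => mul_norm_sq_nonneg_of_mem_coordSubspace hw hx i

theorem sum_mul_norm_sq_pos_of_mem_coordSubspace [Fintype ι] (hw : ∀ i, p i → 0 < w i)
    (hx : x ∈ coordSubspace c p) (hx0 : x ≠ 0) : 0 < ∑ i, w i * ‖c x i‖ ^ 2 := by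
  have hterm := mul_norm_sq_nonneg_of_mem_coordSubspace (fun i hi => (hw i hi).le) hx
  refine (Finset.sum_nonneg fun i _ => hterm i).lt_of_ne' fun hsum => hx0 ?_
  refine c.map_eq_zero_iff.1 (funext fun i => ?_)
  by_cases hi : p i
  · have := (Finset.sum_eq_zero_iff_of_nonneg fun i _ => hterm i).1 hsum i (Finset.mem_univ i)
    simpa [(hw i hi).ne'] using this
  · exact mem_coordSubspace.1 hx i hi

end WeightedSum

/-- Coordinates diagonalizing the Hermitian form `Σ Aᵢⱼ ηᵢ η̄ⱼ`. -/
theorem Matrix.IsHermitian.exists_coord_sum_mul_conj {m : ℕ} {A : Matrix (Fin m) (Fin m) ℂ}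
    (hA : A.IsHermitian) :
    ∃ c : EuclideanSpace ℂ (Fin m) ≃ₗ[ℂ] (Fin m → ℂ), ∀ v : EuclideanSpace ℂ (Fin m),
      (∑ i, ∑ j, A i j * v i * (starRingEnd ℂ) (v j)).re =
        ∑ k, hA.eigenvalues k * ‖c v k‖ ^ 2 := by
  let U : Matrix (Fin m) (Fin m) ℂ := hA.eigenvectorUnitary
  have hU : IsUnit U.transpose := by
    rw [Matrix.isUnit_transpose U]
    exact (Unitary.toUnits hA.eigenvectorUnitary).isUnit
  have hAU (i j : Fin m) :
      A i j = ∑ k, U i k * (hA.eigenvalues k : ℂ) * (starRingEnd ℂ) (U j k) := by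
    conv_lhs => rw [hA.spectral_theorem, Unitary.conjStarAlgAut_apply]
    simp [Matrix.mul_apply, Matrix.diagonal_apply, U, Matrix.star_apply]
  refine ⟨(WithLp.linearEquiv 2 ℂ (Fin m → ℂ)).trans
    (Matrix.toLinearEquiv' U.transpose hU.invertible), fun v => ?_⟩
  have hc (k : Fin m) : (((WithLp.linearEquiv 2 ℂ (Fin m → ℂ)).trans
      (Matrix.toLinearEquiv' U.transpose hU.invertible)) v k) = ∑ i, U i k * v i := by
    simp [Matrix.toLinearEquiv', Matrix.vecMul, dotProduct, mul_comm]
  simp_rw [hc]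
  have : ∑ i, ∑ j, A i j * v i * (starRingEnd ℂ) (v j) =
      ∑ k, ((hA.eigenvalues k * ‖∑ i, U i k * v i‖ ^ 2 : ℝ) : ℂ) := by
    push_cast
    simp_rw [← mul_conj', map_sum, hAU, Finset.sum_mul, Finset.mul_sum]
    rw [Finset.sum_comm_cycle]
    refine Finset.sum_congr rfl fun k _ => ?_
    refine Finset.sum_congr rfl fun i _ => Finset.sum_congr rfl fun j _ => ?_
    simp only [map_mul]
    ring
  rw [this, ← ofReal_sum, ofReal_re]

end LinearAlgebra

/-- Proposition 6.2(i), pointwise special-frame version: the restriction of the Levi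
form of the squared-norm function to the maximal complex tangent space of the level
set at `(0, ξ₀)` has exactly `t + r - 1` positive and `s` negative eigenvalues. -/
theorem levi_form_signature_on_level_set
    {m r : ℕ} (hm : 1 ≤ m) (hr : 1 ≤ r)
    {W : Set (EuclideanSpace ℂ (Fin m))} (hW : IsOpen W)
    (h0W : (0 : EuclideanSpace ℂ (Fin m)) ∈ W)
    {h : EuclideanSpace ℂ (Fin m) → Fin r → Fin r → ℂ}
    (hC2 : ∀ ρ σ : Fin r, ContDiffOn ℝ 2 (fun z => h z ρ σ) W)
    (hherm : ∀ z ∈ W, ∀ ρ σ : Fin r, h z ρ σ = (starRingEnd ℂ) (h z σ ρ))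
    (hid : ∀ ρ σ : Fin r, h 0 ρ σ = if ρ = σ then 1 else 0)
    (hd0 : ∀ ρ σ : Fin r, fderiv ℝ (fun z => h z ρ σ) 0 = 0)
    {ξ₀ : EuclideanSpace ℂ (Fin r)} (hξ₀ : ξ₀ ≠ 0)
    {A : Matrix (Fin m) (Fin m) ℂ}
    (hAdef : ∀ i j : Fin m, A i j =
      -∑ ρ : Fin r, ∑ σ : Fin r,
        wDz i (wDzbar j (fun z => h z ρ σ)) 0 * ξ₀ σ * (starRingEnd ℂ) (ξ₀ ρ))
    (hA : A.IsHermitian)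
    {s t : ℕ}
    (hs : Fintype.card {i // 0 < hA.eigenvalues i} = s)
    (ht : Fintype.card {i // hA.eigenvalues i < 0} = t) :
    -- on the complex hyperplane `H = {(η,ζ) : Σ_ρ ζ_ρ ξ̄₀_ρ = 0}` the Levi form has
    -- exactly `t + r - 1` positive eigenvalues …
    ((∃ V : Submodule ℂ (EuclideanSpace ℂ (Fin m) × EuclideanSpace ℂ (Fin r)),
        (V : Set (EuclideanSpace ℂ (Fin m) × EuclideanSpace ℂ (Fin r))) ⊆
          {v | ∑ ρ : Fin r, v.2 ρ * (starRingEnd ℂ) (ξ₀ ρ) = 0} ∧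
        Module.finrank ℂ V = t + r - 1 ∧
        ∀ v ∈ V, v ≠ 0 → 0 < leviForm (sqNormFun h) (0, ξ₀) v) ∧
      (∀ V : Submodule ℂ (EuclideanSpace ℂ (Fin m) × EuclideanSpace ℂ (Fin r)),
        (V : Set (EuclideanSpace ℂ (Fin m) × EuclideanSpace ℂ (Fin r))) ⊆
          {v | ∑ ρ : Fin r, v.2 ρ * (starRingEnd ℂ) (ξ₀ ρ) = 0} →
        (∀ v ∈ V, v ≠ 0 → 0 < leviForm (sqNormFun h) (0, ξ₀) v) →
          Module.finrank ℂ V ≤ t + r - 1)) ∧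
    -- … and exactly `s` negative eigenvalues
    ((∃ V : Submodule ℂ (EuclideanSpace ℂ (Fin m) × EuclideanSpace ℂ (Fin r)),
        (V : Set (EuclideanSpace ℂ (Fin m) × EuclideanSpace ℂ (Fin r))) ⊆
          {v | ∑ ρ : Fin r, v.2 ρ * (starRingEnd ℂ) (ξ₀ ρ) = 0} ∧
        Module.finrank ℂ V = s ∧
        ∀ v ∈ V, v ≠ 0 → leviForm (sqNormFun h) (0, ξ₀) v < 0) ∧
      (∀ V : Submodule ℂ (EuclideanSpace ℂ (Fin m) × EuclideanSpace ℂ (Fin r)),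
        (V : Set (EuclideanSpace ℂ (Fin m) × EuclideanSpace ℂ (Fin r))) ⊆
          {v | ∑ ρ : Fin r, v.2 ρ * (starRingEnd ℂ) (ξ₀ ρ) = 0} →
        (∀ v ∈ V, v ≠ 0 → leviForm (sqNormFun h) (0, ξ₀) v < 0) →
          Module.finrank ℂ V ≤ s)) := by
  obtain ⟨c, hc⟩ := hA.exists_coord_sum_mul_conj
  have hL (v : EuclideanSpace ℂ (Fin m) × EuclideanSpace ℂ (Fin r)) :
      leviForm (sqNormFun h) (0, ξ₀) v =
        ‖v.2‖ ^ 2 - ∑ k, hA.eigenvalues k * ‖c v.1 k‖ ^ 2 := by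
    rw [leviForm_sqNormFun (fun ρ σ => (hC2 ρ σ).contDiffAt (hW.mem_nhds h0W)) hid hd0, ← hc]
    simp only [hAdef, neg_mul, Finset.sum_neg_distrib, neg_re, sub_neg_eq_add]
  let K : Submodule ℂ (EuclideanSpace ℂ (Fin r)) := (ℂ ∙ ξ₀)ᗮ
  have hK (x : EuclideanSpace ℂ (Fin r)) :
      x ∈ K ↔ ∑ ρ, x ρ * (starRingEnd ℂ) (ξ₀ ρ) = 0 := by
    rw [Submodule.mem_orthogonal_singleton_iff_inner_right]
    simp [PiLp.inner_apply]
  have hKdim : Module.finrank ℂ K + 1 = r := by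
    have := Submodule.finrank_add_finrank_orthogonal (ℂ ∙ ξ₀)
    rw [finrank_span_singleton hξ₀, finrank_euclideanSpace_fin] at this
    change Module.finrank ℂ (ℂ ∙ ξ₀)ᗮ + 1 = r
    omega
  have hHdim : Module.finrank ℂ ((⊤ : Submodule ℂ (EuclideanSpace ℂ (Fin m))).prod K) =
      m + Module.finrank ℂ K := by
    rw [Submodule.finrank_prod_eq, finrank_top, finrank_euclideanSpace_fin]
  have hpos_dim : Module.finrank ℂ (coordSubspace c fun k => 0 < hA.eigenvalues k) = s := by
    rw [finrank_coordSubspace, ← hs]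
  have hneg_dim : Module.finrank ℂ (coordSubspace c fun k => hA.eigenvalues k < 0) = t := by
    rw [finrank_coordSubspace, ← ht]
  have hnonpos_dim :
      Module.finrank ℂ (coordSubspace c fun k => ¬ 0 < hA.eigenvalues k) + s = m := by
    rw [finrank_coordSubspace, Fintype.card_subtype_compl, hs, Fintype.card_fin]
    have := Fintype.card_subtype_le fun k => 0 < hA.eigenvalues k
    rw [hs, Fintype.card_fin] at this
    exact Nat.sub_add_cancel this
  have hnonneg_dim :
      Module.finrank ℂ (coordSubspace c fun k => ¬ hA.eigenvalues k < 0) + t = m := by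
    rw [finrank_coordSubspace, Fintype.card_subtype_compl, ht, Fintype.card_fin]
    have := Fintype.card_subtype_le fun k => hA.eigenvalues k < 0
    rw [ht, Fintype.card_fin] at this
    exact Nat.sub_add_cancel this
  refine ⟨⟨⟨(coordSubspace c fun k => hA.eigenvalues k < 0).prod K, ?_, ?_, ?_⟩, ?_⟩,
    ⟨(coordSubspace c fun k => 0 < hA.eigenvalues k).prod ⊥, ?_, ?_, ?_⟩, ?_⟩
  · exact fun v hv => (hK _).1 hv.2
  · rw [Submodule.finrank_prod_eq, hneg_dim]
    omega
  · intro v hv hv0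
    rw [hL, sub_eq_add_neg, ← Finset.sum_neg_distrib]
    simp only [← neg_mul]
    by_cases hv1 : v.1 = 0
    · have hv2 : v.2 ≠ 0 := fun hv2 => hv0 (Prod.ext hv1 hv2)
      simp [hv1, hv2]
    · exact add_pos_of_nonneg_of_pos (sq_nonneg _) (sum_mul_norm_sq_pos_of_mem_coordSubspace
        (fun k hk => neg_pos.2 hk) hv.1 hv1)
  · intro V hV hVpos
    have hdisj : Disjoint V ((coordSubspace c fun k => ¬ hA.eigenvalues k < 0).prod ⊥) := by
      rw [Submodule.disjoint_def]
      intro v hv hvN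
      by_contra hv0
      have hlt := hVpos v hv hv0
      rw [hL, show v.2 = 0 from hvN.2] at hlt
      have : 0 ≤ ∑ k, hA.eigenvalues k * ‖c v.1 k‖ ^ 2 :=
        sum_mul_norm_sq_nonneg_of_mem_coordSubspace (fun k hk => not_lt.1 hk) hvN.1
      simp at hlt
      linarith
    have := Submodule.finrank_add_finrank_le_of_disjoint_of_le hdisj
      (H := (⊤ : Submodule ℂ (EuclideanSpace ℂ (Fin m))).prod K)
      (fun v hv => ⟨trivial, (hK _).2 (hV hv)⟩)
      (Submodule.prod_mono le_top bot_le)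
    rw [hHdim, Submodule.finrank_prod_eq, finrank_bot] at this
    omega
  · rintro v ⟨-, hv⟩
    exact (hK _).1 ((Submodule.mem_bot ℂ).1 hv ▸ K.zero_mem)
  · rw [Submodule.finrank_prod_eq, hpos_dim, finrank_bot, add_zero]
  · intro v hv hv0
    have hv2 : v.2 = 0 := hv.2
    have := sum_mul_norm_sq_pos_of_mem_coordSubspace (fun k hk => hk) hv.1
      fun hv1 => hv0 (Prod.ext hv1 hv2)
    simpa [hL, hv2] using this
  · intro V hV hVneg
    have hdisj : Disjoint V ((coordSubspace c fun k => ¬ 0 < hA.eigenvalues k).prod K) := by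
      rw [Submodule.disjoint_def]
      intro v hv hvN
      by_contra hv0
      have hlt := hVneg v hv hv0
      rw [hL] at hlt
      have : 0 ≤ ∑ k, -hA.eigenvalues k * ‖c v.1 k‖ ^ 2 :=
        sum_mul_norm_sq_nonneg_of_mem_coordSubspace
          (fun k hk => neg_nonneg.2 (not_lt.1 hk)) hvN.1
      simp only [neg_mul, Finset.sum_neg_distrib] at this
      linarith [sq_nonneg ‖v.2‖]
    have := Submodule.finrank_add_finrank_le_of_disjoint_of_le hdisj
      (H := (⊤ : Submodule ℂ (EuclideanSpace ℂ (Fin m))).prod K)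
      (fun v hv => ⟨trivial, (hK _).2 (hV hv)⟩)
      (Submodule.prod_mono le_top le_rfl)
    rw [hHdim, Submodule.finrank_prod_eq] at this
    omega

end
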